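/- The cube contains the Stasheff polytope: for every planar binary tree t ∈ Y_n, the point M(t) lies in the convex hull of the 2^{n−1} cube vertices {M(ε) : ε ∈ {0,1}^{n−1}} ⊂ ℝ^n; consequently the convex hull of {M(t) : t ∈ Y_n} is contained in the convex hull of {M(ε) : ε ∈ {0,1}^{n−1}}. -/

import Mathlib

/-- Planar binary trees: a tree is either a single leaf, or the grafting
`node l r = l ∨ r` of two planar binary trees. `Y n` is the set of such trees with
`n + 1` leaves. -/
inductive PBT : Type
  | leaf : PBT
  | node : PBT → PBT → PBT
  deriving DecidableEq

namespace PBT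

/-- Number of leaves of a planar binary tree. A tree of `Y n` has `n + 1` leaves. -/
def leaves : PBT → ℕ
  | leaf => 1
  | node l r => l.leaves + r.leaves

/-- The list of coordinates of Loday's point `M(t)`: `M(|)` is the empty tuple and
`M(t^l ∨ t^r) = (M(t^l), p·q, M(t^r))` where `p`, `q` are the numbers of leaves of
`t^l`, `t^r`.  The `i`-th entry is the weight `a_i · b_i` of the `i`-th internal
vertex of `t`.  A tree `t` belongs to `Y n` iff `t.coords.length = n`. -/
noncomputable def coords : PBT → List ℝ
  | leaf => []
  | node l r => l.coords ++ ((l.leaves : ℝ) * (r.leaves : ℝ)) :: r.coords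

/-- The point `M(t) = (a_1 b_1, …, a_n b_n) ∈ ℝ^n`, for `t ∈ Y n`
(coordinates indexed by `Fin n`, the `i`-th coordinate being `x_{i+1}`). -/
noncomputable def M (n : ℕ) (t : PBT) : Fin n → ℝ := fun i => t.coords.getD i 0

end PBT

/-- `ε = (ε_1, …, ε_{n−1}) ∈ {0,1}^{n−1}`, with the convention `ε_0 = ε_n = 0`. -/
def CubeEps (n : ℕ) (ε : ℕ → ℝ) : Prop :=
  ε 0 = 0 ∧ ε n = 0 ∧ ∀ i, ε i = 0 ∨ ε i = 1

/-- The cube vertex `M(ε) ∈ ℝ^n`: `x_i = i − ε_{i−1}(n−i+1)(i−1) + ε_i(n−i)i` for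
`i = 1, …, n` (0-indexed `j = i − 1`). -/
noncomputable def Mcube (n : ℕ) (ε : ℕ → ℝ) : Fin n → ℝ :=
  fun j => (((j : ℕ) : ℝ) + 1) - ε (j : ℕ) * ((n : ℝ) - ((j : ℕ) : ℝ)) * ((j : ℕ) : ℝ)
    + ε ((j : ℕ) + 1) * ((n : ℝ) - ((j : ℕ) : ℝ) - 1) * (((j : ℕ) : ℝ) + 1)

namespace PBT

theorem leaves_eq_length_add_one (t : PBT) : t.leaves = t.coords.length + 1 := by
  induction t with
  | leaf => rfl
  | node l r ihl ihr => simp only [leaves, coords, List.length_append, List.length_cons]; omega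

/-- The partial sums of the coordinates of `M(t)` lie between those of the identity
point `(1, …, n)` and those of the reversed point `(n, …, 1)`. -/
theorem sum_take_coords_bounds (t : PBT) (k : ℕ) (hk : k ≤ t.coords.length) :
    (k : ℝ) * (k + 1) / 2 ≤ (t.coords.take k).sum ∧
      (t.coords.take k).sum ≤ (k : ℝ) * (k + 1) / 2 + (t.coords.length - k) * k := by
  induction t generalizing k with
  | leaf =>
    obtain rfl : k = 0 := by simpa [coords] using hk
    simp [coords]
  | node l r ihl ihr =>
    have hl := l.leaves_eq_length_add_one
    have hr := r.leaves_eq_length_add_one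
    have hlen : (node l r).coords.length = l.coords.length + r.coords.length + 1 := by
      simp only [coords, List.length_append, List.length_cons]; omega
    rw [hlen] at hk ⊢
    simp only [coords, hl, hr]
    set a := l.coords.length
    set b := r.coords.length
    rcases le_or_gt k a with h | h
    · obtain ⟨h1, h2⟩ := ihl k h
      rw [List.take_append_of_le_length h]
      refine ⟨h1, h2.trans ?_⟩
      push_cast
      gcongr
      linarith [Nat.cast_nonneg (α := ℝ) b]
    · obtain ⟨m, rfl⟩ := Nat.exists_eq_add_of_le h
      have hm : m ≤ b := by omega
      obtain ⟨h1, h2⟩ := ihr m hm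
      obtain ⟨h3, h4⟩ := ihl a le_rfl
      rw [List.take_of_length_le le_rfl] at h3 h4
      have hsplit : a.succ + m = a + (m + 1) := by omega
      rw [hsplit, List.take_length_add_append, List.take_succ_cons, List.sum_append, List.sum_cons]
      have hmb : (m : ℝ) ≤ b := by exact_mod_cast hm
      have hprod := mul_nonneg (sub_nonneg.2 hmb) (Nat.cast_nonneg (α := ℝ) a)
      push_cast
      constructor <;> nlinarith

end PBT

theorem Mcube_eq_update_add_update (n m : ℕ) (θ : ℕ → ℝ) :
    Mcube n θ = (1 - θ m) • Mcube n (Function.update θ m 0) +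
      θ m • Mcube n (Function.update θ m 1) := by
  funext j
  simp only [Mcube, Pi.add_apply, Pi.smul_apply, smul_eq_mul, Function.update_apply]
  split_ifs with h1 h2 h2
  · omega
  · rw [h1]; ring
  · rw [h2]; ring
  · ring

/-- The cube `{Mcube n θ | θ ∈ [0, 1]^(n - 1)}` is the convex hull of its vertices. -/
theorem Mcube_mem_convexHull (n : ℕ) (θ : ℕ → ℝ) (h0 : θ 0 = 0) (hn : θ n = 0)
    (hθ : ∀ i, θ i ∈ Set.Icc (0 : ℝ) 1) (m : ℕ) (hm : ∀ i, m ≤ i → θ i = 0 ∨ θ i = 1) :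
    Mcube n θ ∈
      convexHull ℝ {x : Fin n → ℝ | ∃ ε : ℕ → ℝ, CubeEps n ε ∧ x = Mcube n ε} := by
  induction m generalizing θ with
  | zero => exact subset_convexHull _ _ ⟨θ, ⟨h0, hn, fun i => hm i i.zero_le⟩, rfl⟩
  | succ m ih =>
    by_cases hθm : θ m = 0 ∨ θ m = 1
    · refine ih θ h0 hn hθ fun i hi => ?_
      rcases hi.eq_or_lt with rfl | hi
      · exact hθm
      · exact hm i hi
    have hm0 : 0 ≠ m := by rintro rfl; exact hθm (.inl h0)
    have hmn : n ≠ m := by rintro rfl; exact hθm (.inl hn)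
    have key (c : ℝ) (hc : c = 0 ∨ c = 1) : Mcube n (Function.update θ m c) ∈
        convexHull ℝ {x : Fin n → ℝ | ∃ ε : ℕ → ℝ, CubeEps n ε ∧ x = Mcube n ε} := by
      refine ih _ (by rwa [Function.update_of_ne hm0]) (by rwa [Function.update_of_ne hmn])
        (fun i => ?_) fun i hi => ?_
      · rw [Function.update_apply]
        split_ifs
        · rcases hc with rfl | rfl <;> simp
        · exact hθ i
      · rw [Function.update_apply]
        split_ifs with h
        · exact hc
        · exact hm i (by omega)
    rw [Mcube_eq_update_add_update n m θ]
    exact convex_convexHull ℝ _ (key 0 (.inl rfl)) (key 1 (.inr rfl))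
      (sub_nonneg.2 (hθ m).2) (hθ m).1 (by ring)

theorem PBT.M_mem_convexHull (n : ℕ) (t : PBT) (ht : t.coords.length = n) :
    PBT.M n t ∈
      convexHull ℝ {x : Fin n → ℝ | ∃ ε : ℕ → ℝ, CubeEps n ε ∧ x = Mcube n ε} := by
  set S : ℕ → ℝ := fun k => (t.coords.take k).sum
  have hS (k : ℕ) (hk : k ≤ n) : 0 ≤ S k - k * (k + 1) / 2 ∧
      S k - k * (k + 1) / 2 ≤ (n - k) * k := by
    obtain ⟨h1, h2⟩ := t.sum_take_coords_bounds k (ht ▸ hk)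
    rw [ht] at h2
    exact ⟨sub_nonneg.2 h1, by linarith⟩
  set θ : ℕ → ℝ := fun k => if k ≤ n then (S k - k * (k + 1) / 2) / ((n - k) * k) else 0
  have hmul (k : ℕ) (hk : k ≤ n) : θ k * ((n - k) * k) = S k - k * (k + 1) / 2 := by
    simp only [θ, if_pos hk]
    by_cases h : ((n : ℝ) - k) * k = 0
    · have := hS k hk
      rw [h] at this ⊢
      rw [mul_zero]
      exact this.1.antisymm this.2
    · exact div_mul_cancel₀ _ h
  have hmem : Mcube n θ ∈
      convexHull ℝ {x : Fin n → ℝ | ∃ ε : ℕ → ℝ, CubeEps n ε ∧ x = Mcube n ε} := by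
    refine Mcube_mem_convexHull n θ (by simp [θ]) (by simp [θ]) (fun i => ?_) (n + 1)
      fun i hi => .inl (if_neg (by omega))
    by_cases hi : i ≤ n
    · obtain ⟨h1, h2⟩ := hS i hi
      simp only [θ, if_pos hi]
      exact ⟨div_nonneg h1 (h1.trans h2), div_le_one_of_le₀ h2 (h1.trans h2)⟩
    · simp [θ, hi]
  convert hmem using 1
  funext j
  have hj : (j : ℕ) < t.coords.length := ht ▸ j.2
  have h1 := hmul j j.2.le
  have h2 := hmul (j + 1) j.2
  have h3 : S (j + 1) = S j + t.coords[(j : ℕ)] := List.sum_take_succ _ _ hj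
  simp only [PBT.M, Mcube, List.getD_eq_getElem _ _ hj]
  push_cast at h2
  linear_combination h1 - h2 - h3

/-- The cube contains the Stasheff polytope: every vertex `M(t)`, `t ∈ Y n`, lies in
the convex hull of the cube vertices `{M(ε) : ε ∈ {0,1}^{n−1}}`; consequently the
convex hull of `{M(t) : t ∈ Y n}` is contained in the convex hull of
`{M(ε) : ε ∈ {0,1}^{n−1}}`. -/
theorem stmt15 (n : ℕ) :
    (∀ t : PBT, t.coords.length = n →
      PBT.M n t ∈
        convexHull ℝ {x : Fin n → ℝ | ∃ ε : ℕ → ℝ, CubeEps n ε ∧ x = Mcube n ε}) ∧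
    convexHull ℝ {x : Fin n → ℝ | ∃ t : PBT, t.coords.length = n ∧ x = PBT.M n t} ⊆
      convexHull ℝ {x : Fin n → ℝ | ∃ ε : ℕ → ℝ, CubeEps n ε ∧ x = Mcube n ε} := by
  refine ⟨PBT.M_mem_convexHull n, convexHull_min ?_ (convex_convexHull ℝ _)⟩
  rintro _ ⟨t, ht, rfl⟩
  exact PBT.M_mem_convexHull n t ht
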